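/- Let V, W ⊂ ℝ^d be convex bodies such that V ∩ W has nonempty interior, let α > −d/2, let ε > 0, and let γ > 0 be a constant such that vol((V∩W) \ (V∩W)_ε) ≤ γ·ε, where (V∩W)_ε := {x ∈ V∩W : dist(x, ∂(V∩W)) > ε} is the inner parallel set. Then | (1/2)·∫_{V∩W} ∫_{V∩W} 1{‖x−y‖<ε}·‖x−y‖^{2α} dx dy − (1/2)·vol(V∩W)·(d·κ_d/(d+2α))·ε^{d+2α} | ≤ (1/2)·γ·(d·κ_d/(d+2α))·ε^{d+2α+1}. -/

import Mathlib

open MeasureTheory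

lemma Metric.ball_subset_of_lt_infDist_frontier {E : Type*} [NormedAddCommGroup E]
    [NormedSpace ℝ E] {K : Set E} (hK : IsClosed K) {y : E} (hy : y ∈ K) {ε : ℝ} (hε : 0 < ε)
    (h : ε < Metric.infDist y (frontier K)) : Metric.ball y ε ⊆ K := by
  have hdisj : ∀ z ∈ Metric.ball y ε, z ∉ frontier K := fun z hz hzf ↦ by
    have h1 := Metric.infDist_le_dist_of_mem (x := y) hzf
    rw [Metric.mem_ball, dist_comm] at hz
    linarith
  have hint : ∀ z ∈ Metric.ball y ε, z ∈ K → z ∈ interior K := fun z hz hzK ↦ by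
    by_contra hzi
    exact hdisj z hz ⟨subset_closure hzK, hzi⟩
  have hsub : Metric.ball y ε ⊆ interior K :=
    (convex_ball y ε).isPreconnected.subset_left_of_subset_union isOpen_interior
      hK.isOpen_compl (disjoint_compl_right.mono_left interior_subset)
      (fun z hz ↦ (em (z ∈ K)).imp (hint z hz) id)
      ⟨y, Metric.mem_ball_self hε, hint y (Metric.mem_ball_self hε) hy⟩
  exact hsub.trans interior_subset

lemma pow_pred_smul_truncated_rpow {n : ℕ} (hn : 0 < n) (p ε : ℝ) :
    Set.EqOn (fun r : ℝ ↦ r ^ (n - 1) • (if r < ε then r ^ p else 0))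
      ((Set.Iio ε).indicator (fun r : ℝ ↦ r ^ ((n : ℝ) + p - 1))) (Set.Ioi 0) := by
  intro r (hr : 0 < r)
  dsimp only
  by_cases h : r < ε
  · have h' : r ∈ Set.Iio ε := h
    rw [if_pos h, Set.indicator_of_mem h', smul_eq_mul, ← Real.rpow_natCast,
      ← Real.rpow_add hr, Nat.cast_pred hn]
    ring_nf
  · simp [h]

lemma integrableOn_Ioo_rpow_sub_one {q ε : ℝ} (hq : 0 < q) (hε : 0 < ε) :
    IntegrableOn (fun r : ℝ ↦ r ^ (q - 1)) (Set.Ioo 0 ε) :=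
  ((intervalIntegrable_iff_integrableOn_Ioo_of_le hε.le).1
    (intervalIntegral.intervalIntegrable_rpow' (by linarith)))

lemma integrable_truncated_norm_rpow {E : Type*} [NormedAddCommGroup E] [NormedSpace ℝ E]
    [FiniteDimensional ℝ E] [Nontrivial E] [MeasurableSpace E] [BorelSpace E] (μ : Measure E)
    [μ.IsAddHaarMeasure] {p ε : ℝ} (hp : 0 < (Module.finrank ℝ E : ℝ) + p) (hε : 0 < ε) :
    Integrable (fun z : E ↦ if ‖z‖ < ε then ‖z‖ ^ p else 0) μ := by
  refine (integrable_fun_norm_addHaar μ (f := fun r : ℝ ↦ if r < ε then r ^ p else 0)).2 ?_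
  refine (integrableOn_congr_fun
    (pow_pred_smul_truncated_rpow Module.finrank_pos p ε) measurableSet_Ioi).2 ?_
  rw [IntegrableOn, integrable_indicator_iff measurableSet_Iio, IntegrableOn,
    Measure.restrict_restrict measurableSet_Iio, Set.Iio_inter_Ioi]
  exact integrableOn_Ioo_rpow_sub_one hp hε

lemma integral_truncated_norm_rpow {E : Type*} [NormedAddCommGroup E] [NormedSpace ℝ E]
    [FiniteDimensional ℝ E] [Nontrivial E] [MeasurableSpace E] [BorelSpace E] (μ : Measure E)
    [μ.IsAddHaarMeasure] {p ε : ℝ} (hp : 0 < (Module.finrank ℝ E : ℝ) + p) (hε : 0 < ε) :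
    ∫ z : E, (if ‖z‖ < ε then ‖z‖ ^ p else 0) ∂μ
      = (Module.finrank ℝ E : ℝ) * μ.real (Metric.ball 0 1) / ((Module.finrank ℝ E : ℝ) + p)
        * ε ^ ((Module.finrank ℝ E : ℝ) + p) := by
  rw [integral_fun_norm_addHaar μ (fun r : ℝ ↦ if r < ε then r ^ p else 0),
    setIntegral_congr_fun measurableSet_Ioi
      (pow_pred_smul_truncated_rpow Module.finrank_pos p ε),
    integral_indicator measurableSet_Iio, Measure.restrict_restrict measurableSet_Iio,
    Set.Iio_inter_Ioi, ← integral_Ioc_eq_integral_Ioo,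
    ← intervalIntegral.integral_of_le hε.le, integral_rpow (Or.inl (by linarith)),
    sub_add_cancel, Real.zero_rpow hp.ne', nsmul_eq_mul, smul_eq_mul]
  ring

/-- Integrating a nonnegative kernel supported in the `ε`-ball over `K × K` misses the product
`vol K * ∫ f` by at most the contribution of the points that are `ε`-close to the boundary. -/
lemma abs_setIntegral_setIntegral_sub_le {E : Type*} [NormedAddCommGroup E] [NormedSpace ℝ E]
    [FiniteDimensional ℝ E] [MeasurableSpace E] [BorelSpace E] (μ : Measure E)
    [μ.IsAddHaarMeasure] {K : Set E} (hK : IsCompact K) {f : E → ℝ} (hfm : Measurable f)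
    (hf : Integrable f μ) (hf0 : ∀ z, 0 ≤ f z) {ε : ℝ} (hε : 0 < ε)
    (hfε : ∀ z, ε ≤ ‖z‖ → f z = 0) :
    |(∫ y in K, ∫ x in K, f (x - y) ∂μ ∂μ) - μ.real K * ∫ z, f z ∂μ|
      ≤ μ.real (K \ {x ∈ K | ε < Metric.infDist x (frontier K)}) * ∫ z, f z ∂μ := by
  set I := ∫ z, f z ∂μ
  set S := {x ∈ K | ε < Metric.infDist x (frontier K)}
  set g : E → ℝ := fun y ↦ ∫ x in K, f (x - y) ∂μ
  have hI0 : 0 ≤ I := integral_nonneg hf0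
  have hshift : ∀ y, Integrable (fun x ↦ f (x - y)) μ := fun y ↦ hf.comp_sub_right y
  have hshiftI : ∀ y, ∫ x, f (x - y) ∂μ = I := fun y ↦ integral_sub_right_eq_self f y
  have hg0 : ∀ y, 0 ≤ g y := fun y ↦ integral_nonneg fun x ↦ hf0 _
  have hgI : ∀ y, g y ≤ I := fun y ↦ by
    rw [← hshiftI y]
    exact setIntegral_le_integral (hshift y) (Filter.Eventually.of_forall fun x ↦ hf0 _)
  have hgS : ∀ y ∈ S, g y = I := fun y hy ↦ by
    rw [← hshiftI y]
    refine setIntegral_eq_integral_of_forall_compl_eq_zero fun x hx ↦ hfε _ ?_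
    by_contra! hlt
    exact hx (Metric.ball_subset_of_lt_infDist_frontier hK.isClosed hy.1 hε hy.2
      (mem_ball_iff_norm.2 hlt))
  have hgm : StronglyMeasurable g :=
    StronglyMeasurable.integral_prod_right' (f := fun q : E × E ↦ f (q.2 - q.1))
      (hfm.comp (measurable_snd.sub measurable_fst)).stronglyMeasurable
  have hKfin : μ K ≠ ⊤ := hK.measure_lt_top.ne
  have hcI : IntegrableOn (fun _ ↦ I) K μ := integrableOn_const hKfin
  have hgi : IntegrableOn g K μ :=
    Integrable.mono' hcI hgm.aestronglyMeasurable (Filter.Eventually.of_forall fun y ↦ by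
      rw [Real.norm_of_nonneg (hg0 y)]; exact hgI y)
  have hSm : MeasurableSet S := hK.isClosed.measurableSet.inter
    (measurableSet_lt measurable_const (Metric.continuous_infDist_pt _).measurable)
  have hDm : MeasurableSet (K \ S) := hK.isClosed.measurableSet.diff hSm
  have hdiff : ∫ y in K, (I - g y) ∂μ = μ.real K * I - ∫ y in K, g y ∂μ := by
    rw [integral_sub hcI hgi, setIntegral_const, smul_eq_mul]
  have hnonneg : 0 ≤ ∫ y in K, (I - g y) ∂μ := integral_nonneg fun y ↦ sub_nonneg.2 (hgI y)
  have hle : ∫ y in K, (I - g y) ∂μ ≤ μ.real (K \ S) * I := by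
    calc ∫ y in K, (I - g y) ∂μ = ∫ y in K \ S, (I - g y) ∂μ := by
          refine (setIntegral_eq_of_subset_of_forall_sdiff_eq_zero hK.isClosed.measurableSet
            Set.sdiff_subset fun y hy ↦ ?_)
          rw [hgS y (by_contra fun h ↦ hy.2 ⟨hy.1, h⟩), sub_self]
      _ ≤ ∫ _ in K \ S, I ∂μ :=
          integral_mono ((hcI.sub hgi).mono_set Set.sdiff_subset)
            (hcI.mono_set Set.sdiff_subset) fun y ↦ sub_le_self _ (hg0 y)
      _ = μ.real (K \ S) * I := by rw [setIntegral_const, smul_eq_mul]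
  rw [abs_sub_comm, ← hdiff, abs_of_nonneg hnonneg]
  exact hle

/-- Asymptotics of the double integral appearing in the covariance computation:
`| (1/2) ∫_{V∩W} ∫_{V∩W} 1{‖x-y‖<ε} ‖x-y‖^{2α} dx dy
   − (1/2) vol(V∩W) (d κ_d/(d+2α)) ε^{d+2α} | ≤ (1/2) γ (d κ_d/(d+2α)) ε^{d+2α+1}`. -/
theorem double_integral_asymptotics (d : ℕ)
    (V W : Set (EuclideanSpace ℝ (Fin d)))
    (hVc : IsCompact V) (hVconv : Convex ℝ V) (hVint : (interior V).Nonempty)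
    (hWc : IsCompact W) (hWconv : Convex ℝ W) (hWint : (interior W).Nonempty)
    (hint : (interior (V ∩ W)).Nonempty)
    (α : ℝ) (hα : -(d : ℝ) / 2 < α) (ε : ℝ) (hε : 0 < ε)
    (γ : ℝ) (hγ : 0 < γ)
    (hγ2 : (volume ((V ∩ W) \
        {x ∈ V ∩ W | ε < Metric.infDist x (frontier (V ∩ W))})).toReal ≤ γ * ε)
    (κ : ℝ) (hκ : κ = (volume (Metric.ball (0 : EuclideanSpace ℝ (Fin d)) 1)).toReal) :
    |(1 / 2) * (∫ y in V ∩ W, ∫ x in V ∩ W,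
          if ‖x - y‖ < ε then ‖x - y‖ ^ (2 * α) else 0)
        - (1 / 2) * (volume (V ∩ W)).toReal * ((d : ℝ) * κ / ((d : ℝ) + 2 * α))
            * ε ^ ((d : ℝ) + 2 * α)|
      ≤ (1 / 2) * γ * ((d : ℝ) * κ / ((d : ℝ) + 2 * α)) * ε ^ ((d : ℝ) + 2 * α + 1) := by
  have hq : 0 < (d : ℝ) + 2 * α := by linarith
  rcases Nat.eq_zero_or_pos d with rfl | hd
  · have hα0 : 2 * α ≠ 0 := by
      rw [Nat.cast_zero, zero_add] at hq
      exact hq.ne'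
    have hzero : ∀ x : EuclideanSpace ℝ (Fin 0), ‖x‖ = 0 := fun x ↦ by
      rw [Subsingleton.elim x 0, norm_zero]
    simp [hzero, Real.zero_rpow hα0]
  have hdim : Module.finrank ℝ (EuclideanSpace ℝ (Fin d)) = d := finrank_euclideanSpace_fin
  have : Nontrivial (EuclideanSpace ℝ (Fin d)) :=
    Module.nontrivial_of_finrank_pos (R := ℝ) (hd.trans_eq hdim.symm)
  have hq' : 0 < (Module.finrank ℝ (EuclideanSpace ℝ (Fin d)) : ℝ) + 2 * α := by rwa [hdim]
  have hI := integral_truncated_norm_rpow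
    (volume : Measure (EuclideanSpace ℝ (Fin d))) hq' hε
  rw [hdim, measureReal_def, ← hκ] at hI
  have hmeas : Measurable fun z : EuclideanSpace ℝ (Fin d) ↦
      if ‖z‖ < ε then ‖z‖ ^ (2 * α) else 0 :=
    Measurable.ite (measurableSet_lt measurable_norm measurable_const)
      (measurable_norm.pow_const _) measurable_const
  have hmain := abs_setIntegral_setIntegral_sub_le volume (hVc.inter hWc) hmeas
    (integrable_truncated_norm_rpow volume hq' hε)
    (fun z ↦ by split_ifs <;> positivity) hε (fun z hz ↦ if_neg hz.not_gt)
  rw [hI, measureReal_def, measureReal_def] at hmain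
  have hκ0 : 0 ≤ κ := hκ ▸ ENNReal.toReal_nonneg
  have hc : 0 ≤ (d : ℝ) * κ / ((d : ℝ) + 2 * α) * ε ^ ((d : ℝ) + 2 * α) := by positivity
  have hbound := hmain.trans (mul_le_mul_of_nonneg_right hγ2 hc)
  rw [Real.rpow_add_one hε.ne']
  rw [abs_le] at hbound ⊢
  constructor <;> linarith [hbound.1, hbound.2]
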